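/- Let n ≥ 3, let σ ∈ S_n satisfy σ(n) = n, and let σ' ∈ S_{n-1} be its restriction to {1,...,n-1}. Let f = c₁(σ) ≥ 1 be the number of fixed points of σ in S_n, so that σ' has f - 1 fixed points. If the standard representation rules for σ' in S_{n-1}, i.e. χ̃'(σ') ≤ (f-2)/(n-2) for every irreducible character χ' of S_{n-1} other than trivial and sign, then the standard representation rules for σ in S_n: χ̃(σ) ≤ (f-1)/(n-1) for every irreducible character χ of S_n other than trivial and sign. -/

import Mathlib

open CategoryTheory

/-- `c₁(σ)`: the number of fixed points of a permutation. -/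
def fixCount {n : ℕ} (σ : Equiv.Perm (Fin n)) : ℕ :=
  (Finset.univ.filter fun x => σ x = x).card

/-- `c_ℓ(σ)`: the number of `ℓ`-cycles of a permutation (for `ℓ ≥ 2`). -/
def cyc {n : ℕ} (ℓ : ℕ) (σ : Equiv.Perm (Fin n)) : ℕ :=
  Multiset.count ℓ σ.cycleType

/-- The (real-valued) normalized character `χ̃(σ) = χ(σ)/χ(1)` of `V` at `σ`. -/
noncomputable def normChar {n : ℕ} (V : FDRep ℂ (Equiv.Perm (Fin n)))
    (σ : Equiv.Perm (Fin n)) : ℝ :=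
  (V.character σ / V.character 1).re

/-- `V` is an irreducible representation whose character is neither the trivial
character nor the sign character. -/
def IsNontrivIrr {n : ℕ} (V : FDRep ℂ (Equiv.Perm (Fin n))) : Prop :=
  Simple V ∧ V.character ≠ (fun _ => 1) ∧
    V.character ≠ (fun σ => ((Equiv.Perm.sign σ : ℤ) : ℂ))

/-- The maximum of the normalized characters `F₁(σ), …, F₈(σ)` at `σ` of the eight
irreps `EIGHT_n = {(n-1,1), (n-2,2), (n-3,3), (n-3,2,1), (n-4,4),
(n-1,1)ᵗ, (n-2,2)ᵗ, (n-2,1,1)ᵗ}`. -/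
noncomputable def maxF (n : ℕ) (σ : Equiv.Perm (Fin n)) : ℝ :=
  let c1 : ℝ := fixCount σ
  let c2 : ℝ := cyc 2 σ
  let c3 : ℝ := cyc 3 σ
  let c4 : ℝ := cyc 4 σ
  let e : ℝ := ((Equiv.Perm.sign σ : ℤ) : ℝ)
  let N : ℝ := n
  let F1 := (c1 - 1) / (N - 1)
  let F2 := (c1 * (c1 - 3) / 2 + c2) / (N * (N - 3) / 2)
  let F3 := (c1 * (c1 - 1) * (c1 - 5) / 6 + (c1 - 1) * c2 + c3) / (N * (N - 1) * (N - 5) / 6)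
  let F4 := (c1 * (c1 - 2) * (c1 - 4) / 3 - c3) / (N * (N - 2) * (N - 4) / 3)
  let F5 := (c1 * (c1 - 1) * (c1 - 2) * (c1 - 7) / 24 + (c1 ^ 2 - 3 * c1 - 1) * c2 / 2
      + c2 ^ 2 / 2 + (c1 - 1) * c3 + c4) / (N * (N - 1) * (N - 2) * (N - 7) / 24)
  let F6 := e * F1
  let F7 := e * F2
  let F8 := e * ((c1 - 1) * (c1 - 2) / 2 - c2) / ((N - 1) * (N - 2) / 2)
  max (max (max F1 F2) (max F3 F4)) (max (max F5 F6) (max F7 F8))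

namespace Subrepresentation

variable {k G V : Type*} [Field k] [Monoid G] [AddCommGroup V] [Module k V]
  {ρ : Representation k G V}

theorem isCompl_toSubmodule {p q : Subrepresentation ρ} (h : IsCompl p q) :
    IsCompl p.toSubmodule q.toSubmodule := by
  refine IsCompl.of_eq ?_ ?_
  · rw [← toSubmodule_inf, h.inf_eq_bot]; rfl
  · rw [← toSubmodule_sup, h.sup_eq_top]; rfl

theorem character_eq_add [FiniteDimensional k V] {p q : Subrepresentation ρ} (h : IsCompl p q)
    (g : G) :
    ρ.character g = p.toRepresentation.character g + q.toRepresentation.character g := by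
  have h' := isCompl_toSubmodule h
  unfold Representation.character
  rw [← LinearMap.trace_prodMap',
    ← LinearMap.trace_conj' _ (Submodule.prodEquivOfIsCompl _ _ h')]
  congr 1
  ext v
  obtain ⟨x, rfl⟩ := (Submodule.prodEquivOfIsCompl _ _ h').surjective v
  simp [LinearEquiv.conj_apply, toRepresentation]

theorem finrank_eq_add [FiniteDimensional k V] {p q : Subrepresentation ρ} (h : IsCompl p q) :
    Module.finrank k V = Module.finrank k p.toSubmodule + Module.finrank k q.toSubmodule :=
  (Submodule.finrank_add_eq_of_isCompl (isCompl_toSubmodule h)).symm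

end Subrepresentation

namespace Representation

/-- In an irreducible representation, an invariant submodule is zero or everything. -/
theorem IsIrreducible.eq_bot_or_eq_top {k G V : Type*} [Field k] [Monoid G] [AddCommGroup V]
    [Module k V] {ρ : Representation k G V} (h : ρ.IsIrreducible) (U : Submodule k V)
    (hU : ∀ g, ∀ u ∈ U, ρ g u ∈ U) : U = ⊥ ∨ U = ⊤ := by
  rcases IsSimpleOrder.eq_bot_or_eq_top (⟨U, fun g u hu => hU g u hu⟩ : Subrepresentation ρ)
    with h | h
  · exact Or.inl (congrArg Subrepresentation.toSubmodule h)
  · exact Or.inr (congrArg Subrepresentation.toSubmodule h)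

theorem character_eq_of_eigenvector {k G V : Type*} [Field k] [Monoid G] [AddCommGroup V]
    [Module k V] [FiniteDimensional k V] {ρ : Representation k G V}
    (h : ∀ U : Submodule k V, (∀ g, ∀ u ∈ U, ρ g u ∈ U) → U = ⊥ ∨ U = ⊤)
    {ε : G → k} {w : V} (hw : w ≠ 0) (hε : ∀ g, ρ g w = ε g • w) : ρ.character = ε := by
  have htop : Submodule.span k {w} = ⊤ := by
    refine (h (Submodule.span k {w}) fun g u hu => ?_).resolve_left (by simpa using hw)
    obtain ⟨a, rfl⟩ := Submodule.mem_span_singleton.1 hu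
    rw [map_smul, hε]
    exact Submodule.smul_mem _ _ (Submodule.smul_mem _ _ (Submodule.mem_span_singleton_self w))
  have hrank : Module.finrank k V = 1 := by
    rw [← finrank_top k V, ← htop, finrank_span_singleton hw]
  ext g
  have : ρ g = ε g • LinearMap.id := by
    ext u
    obtain ⟨a, rfl⟩ := Submodule.mem_span_singleton.1 (htop ▸ Submodule.mem_top : u ∈ _)
    simp [hε, smul_comm a]
  rw [character, this, map_smul, LinearMap.trace_id, hrank]
  simp

theorem apply_eq_smul_of_finrank_eq_one {k G V : Type*} [Field k] [Monoid G] [AddCommGroup V]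
    [Module k V] [FiniteDimensional k V] (ρ : Representation k G V) (h : Module.finrank k V = 1)
    (g : G) (w : V) :
    ρ g w = ρ.character g • w := by
  obtain ⟨c, hc⟩ := (LinearMap.existsUnique_eq_smul_id_of_finrank_eq_one h (ρ g)).exists
  rw [character, hc, map_smul, LinearMap.trace_id, h]
  simp

/-- A bound for the characters of irreducible representations avoiding a set of one-dimensional
characters extends to all representations avoiding these characters. -/
theorem re_character_le_of_irreducible {G : Type} [Group G] [Finite G] (S : Set (G → ℂ)) (c : ℝ)
    (g : G)
    (hirr : ∀ (W : Type) [AddCommGroup W] [Module ℂ W] [FiniteDimensional ℂ W]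
      (τ : Representation ℂ G W), τ.IsIrreducible →
      (∀ ε ∈ S, ∀ w, (∀ x, τ x w = ε x • w) → w = 0) →
      (τ.character g).re ≤ c * Module.finrank ℂ W)
    (V : Type) [AddCommGroup V] [Module ℂ V] [FiniteDimensional ℂ V]
    (ρ : Representation ℂ G V) (hρ : ∀ ε ∈ S, ∀ w, (∀ x, ρ x w = ε x • w) → w = 0) :
    (ρ.character g).re ≤ c * Module.finrank ℂ V := by
  induction hn : Module.finrank ℂ V using Nat.strong_induction_on generalizing V with
  | _ n ih =>
  subst hn
  by_cases hV : ρ.IsIrreducible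
  · exact hirr V ρ hV hρ
  rcases subsingleton_or_nontrivial V with hs | hs
  · have : ρ g = 0 := Subsingleton.elim _ _
    simp [character, this, Module.finrank_zero_of_subsingleton]
  have : ∃ p : Subrepresentation ρ, p ≠ ⊥ ∧ p ≠ ⊤ := by
    by_contra! hcon
    have : Nontrivial (Subrepresentation ρ) := by
      refine ⟨⊥, ⊤, fun h => ?_⟩
      exact bot_ne_top (congrArg Subrepresentation.toSubmodule h : (⊥ : Submodule ℂ V) = ⊤)
    exact hV ⟨fun p => or_iff_not_imp_left.2 (hcon p)⟩
  obtain ⟨p, hp0, hp1⟩ := this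
  have : NeZero (Nat.card G : ℂ) := ⟨by simp [Nat.card_pos.ne']⟩
  obtain ⟨q, hpq⟩ := exists_isCompl p
  have hsub : ∀ r : Subrepresentation ρ, ∀ ε ∈ S, ∀ w,
      (∀ x, r.toRepresentation x w = ε x • w) → w = 0 := by
    intro r ε hε w hw
    exact Subtype.ext (hρ ε hε w fun x => congrArg Subtype.val (hw x))
  have hpos : ∀ r : Subrepresentation ρ, r ≠ ⊥ → 0 < Module.finrank ℂ r.toSubmodule := by
    intro r hr
    rw [Module.finrank_pos_iff, Submodule.nontrivial_iff_ne_bot]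
    exact fun h => hr (Subrepresentation.toSubmodule_injective h)
  have hq0 : q ≠ ⊥ := by
    rintro rfl
    exact hp1 (by simpa using hpq.sup_eq_top)
  have hadd := Subrepresentation.finrank_eq_add hpq
  have h1 := ih _ (by have := hpos q hq0; omega) _ p.toRepresentation (hsub p) rfl
  have h2 := ih _ (by have := hpos p hp0; omega) _ q.toRepresentation (hsub q) rfl
  rw [Subrepresentation.character_eq_add hpq, hadd, Complex.add_re]
  push_cast
  linarith

section Perm

variable {α : Type*} [Fintype α] [DecidableEq α]

theorem trace_funLeft {k : Type*} [Field k] (g : Equiv.Perm α) :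
    LinearMap.trace k (α → k) (LinearMap.funLeft k k g) =
      (Finset.univ.filter fun x => g x = x).card := by
  rw [LinearMap.trace_eq_matrix_trace k (Pi.basisFun k α), Matrix.trace]
  simp [LinearMap.funLeft_apply, Pi.single_apply]

/-- A nontrivial irreducible representation of `Perm α` with a nonzero vector fixed by a point
stabilizer has the character of the standard representation. -/
theorem character_eq_of_stabilizer_fixed {V : Type*} [AddCommGroup V] [Module ℂ V]
    [FiniteDimensional ℂ V] (ρ : Representation ℂ (Equiv.Perm α) V)
    (h : ∀ U : Submodule ℂ V, (∀ g, ∀ u ∈ U, ρ g u ∈ U) → U = ⊥ ∨ U = ⊤)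
    (hfix : ∀ w, (∀ g, ρ g w = w) → w = 0) (a : α) {v : V} (hv0 : v ≠ 0)
    (hv : ∀ g, g a = a → ρ g v = v) (g : Equiv.Perm α) :
    ρ.character g = (Finset.univ.filter fun x => g x = x).card - 1 := by
  set u : α → V := fun i => ρ (Equiv.swap a i) v with hu
  have hmul : ∀ (x y : Equiv.Perm α) w, ρ x (ρ y w) = ρ (x * y) w := fun x y w => by
    rw [map_mul]; rfl
  have hgu : ∀ (x : Equiv.Perm α) i, ρ x (u i) = u (x i) := by
    intro x i
    have := hv ((Equiv.swap a (x i)) * x * Equiv.swap a i) (by simp)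
    simp only [hu]
    conv_rhs => rw [← this]
    simp only [hmul]
    congr 2
    simp [← mul_assoc]
  have hua : u a = v := by
    simp [hu, Equiv.swap_self, ← Equiv.Perm.one_def]
  have hsum : ∑ i, u i = 0 := by
    refine hfix _ fun x => ?_
    rw [map_sum]
    simp only [hgu]
    exact Equiv.sum_comp x u
  have hinj : ∀ i j, i ≠ j → u i ≠ u j := by
    intro i j hij huij
    have hconst : ∀ l, u l = v := by
      intro l
      rcases eq_or_ne l a with rfl | hl
      · exact hua
      have hb : Equiv.swap i a j ≠ a := fun hb => hij <| by
        simpa using (Equiv.swap_apply_eq_iff.1 hb).symm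
      have := congrArg (ρ (Equiv.swap (Equiv.swap i a j) l * Equiv.swap i a)) huij
      rw [hgu, hgu] at this
      simp only [Equiv.Perm.mul_apply, Equiv.swap_apply_left,
        Equiv.swap_apply_of_ne_of_ne hb.symm hl.symm] at this
      rw [← this, hua]
    exact hv0 (hfix v fun x => by rw [← hua, hgu, hconst, hua])
  have hspan : Submodule.span ℂ (Set.range u) = ⊤ := by
    refine (h _ fun x w hw => ?_).resolve_left fun hbot => ?_
    · have : Submodule.span ℂ (Set.range u) ≤ (Submodule.span ℂ (Set.range u)).comap (ρ x) := by
        rw [Submodule.span_le]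
        rintro _ ⟨i, rfl⟩
        simp only [Submodule.comap_coe, Set.mem_preimage, hgu]
        exact Submodule.subset_span ⟨_, rfl⟩
      exact this hw
    · have : u a ∈ Submodule.span ℂ (Set.range u) := Submodule.subset_span ⟨a, rfl⟩
      rw [hbot, hua] at this
      exact hv0 (by simpa using this)
  let Φ : (α → ℂ) →ₗ[ℂ] V × ℂ :=
    (Fintype.linearCombination ℂ u).prod (Fintype.linearCombination ℂ fun _ => (1 : ℂ))
  have hΦ : ∀ x, Φ x = (∑ i, x i • u i, ∑ i, x i) := fun x => by
    simp [Φ, Fintype.linearCombination_apply]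
  have hequiv : ∀ (g : Equiv.Perm α) x, Φ (x ∘ g) = (ρ g⁻¹ (Φ x).1, (Φ x).2) := by
    intro g x
    simp only [hΦ, map_sum, map_smul, hgu, Function.comp_apply]
    rw [Equiv.sum_comp g x, ← Equiv.sum_comp g fun i => x i • u (g⁻¹ i)]
    simp
  have hcard : (Fintype.card α : ℂ) ≠ 0 := by
    exact_mod_cast (Fintype.card_pos_iff.2 ⟨a⟩).ne'
  have hinjΦ : Function.Injective Φ := by
    rw [← LinearMap.ker_eq_bot, LinearMap.ker_eq_bot']
    intro x hx
    rw [hΦ, Prod.mk_eq_zero] at hx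
    have hconst : ∀ i j, x i = x j := by
      intro i j
      by_contra hne
      have hij : i ≠ j := fun h => hne (congrArg x h)
      have h1 : ∑ l, (x l - x (Equiv.swap i j l)) • u l = 0 := by
        have h2 := congrArg (ρ (Equiv.swap i j)) hx.1
        simp only [map_sum, map_smul, hgu, map_zero] at h2
        rw [← Equiv.sum_comp (Equiv.swap i j)] at h2
        simp only [Equiv.swap_apply_self] at h2
        simp only [sub_smul, Finset.sum_sub_distrib, hx.1, h2, sub_zero]
      rw [Finset.sum_eq_add_of_mem i j (Finset.mem_univ _) (Finset.mem_univ _) hij] at h1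
      · rw [Equiv.swap_apply_left, Equiv.swap_apply_right, ← neg_sub (x i) (x j), neg_smul,
          ← sub_eq_add_neg, ← smul_sub] at h1
        exact hinj i j hij
          (sub_eq_zero.1 ((smul_eq_zero.1 h1).resolve_left (sub_ne_zero.2 hne)))
      · rintro l - ⟨hli, hlj⟩
        rw [Equiv.swap_apply_of_ne_of_ne hli hlj, sub_self, zero_smul]
    have h3 := hx.2
    rw [Finset.sum_congr rfl fun i _ => hconst i a, Finset.sum_const, nsmul_eq_mul] at h3
    have h4 : x a = 0 := (mul_eq_zero.1 h3).resolve_left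
      (by simpa [Finset.card_univ] using hcard)
    exact funext fun i => (hconst i a).trans h4
  have hsurjΦ : Function.Surjective Φ := by
    have h01 : ((0 : V), (1 : ℂ)) ∈ LinearMap.range Φ := by
      refine ⟨fun _ => (Fintype.card α : ℂ)⁻¹, ?_⟩
      simp [hΦ, ← Finset.smul_sum, hsum, hcard]
    have hV : ⊤ ≤ (LinearMap.range Φ).comap (LinearMap.inl ℂ V ℂ) := by
      rw [← hspan, Submodule.span_le]
      rintro _ ⟨i, rfl⟩
      have hi : (u i, (1 : ℂ)) ∈ LinearMap.range Φ :=
        ⟨Pi.single i 1, by simp [Φ, Fintype.linearCombination_apply_single]⟩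
      simpa using sub_mem hi h01
    rintro ⟨w, c⟩
    have := (LinearMap.range Φ).add_mem (hV (Submodule.mem_top : w ∈ ⊤))
      ((LinearMap.range Φ).smul_mem c h01)
    simpa using this
  let e := LinearEquiv.ofBijective Φ ⟨hinjΦ, hsurjΦ⟩
  have hconj : e.conj (LinearMap.funLeft ℂ ℂ (g⁻¹ : Equiv.Perm α)) =
      (ρ g).prodMap LinearMap.id := by
    refine LinearMap.ext fun y => ?_
    obtain ⟨x, rfl⟩ := e.surjective y
    rw [LinearEquiv.conj_apply_apply, LinearEquiv.symm_apply_apply]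
    exact (hequiv g⁻¹ x).trans (by rw [inv_inv]; rfl)
  have htr := LinearMap.trace_conj' (LinearMap.funLeft ℂ ℂ (g⁻¹ : Equiv.Perm α)) e
  rw [hconj, LinearMap.trace_prodMap', LinearMap.trace_id, trace_funLeft,
    Module.finrank_self] at htr
  rw [character, eq_sub_iff_add_eq, ← Nat.cast_one, htr]
  refine congrArg (fun s : Finset α => (s.card : ℂ)) (Finset.filter_congr fun x _ => ?_)
  rw [Equiv.Perm.inv_eq_iff_eq, eq_comm]

end Perm

end Representation

namespace FDRep

theorem isIrreducible_of_simple {k G : Type} [Field k] [Group G] (V : FDRep k G) [Simple V] :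
    Representation.IsIrreducible V.ρ := by
  have hnt : Nontrivial V := by
    by_contra hcon
    rw [not_nontrivial_iff_subsingleton] at hcon
    refine id_nonzero V ?_
    ext x
    exact Subsingleton.elim (α := V) _ _
  have : Nontrivial (Subrepresentation V.ρ) := by
    refine ⟨⊥, ⊤, fun h => ?_⟩
    exact bot_ne_top (congrArg Subrepresentation.toSubmodule h : (⊥ : Submodule k V) = ⊤)
  refine ⟨fun p => or_iff_not_imp_left.2 fun hp => ?_⟩
  let f : FDRep.of p.toRepresentation ⟶ V :=
    ⟨InducedCategory.homMk (ModuleCat.ofHom p.toSubmodule.subtype), fun g => rfl⟩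
  have hf : Function.Injective f := Subtype.val_injective
  have : Mono f := ConcreteCategory.mono_of_injective f hf
  have hf0 : f ≠ 0 := by
    intro h0
    refine hp (Subrepresentation.toSubmodule_injective ((Submodule.eq_bot_iff _).2 fun x hx => ?_))
    exact congrArg (fun φ : FDRep.of p.toRepresentation ⟶ V => φ.hom ⟨x, hx⟩) h0
  have := isIso_of_mono_of_nonzero hf0
  have hsurj : Function.Surjective f := (ConcreteCategory.bijective_of_isIso f).2
  refine Subrepresentation.toSubmodule_injective ((Submodule.eq_top_iff').2 fun x => ?_)
  obtain ⟨y, rfl⟩ := hsurj x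
  exact Subtype.property y

theorem simple_of_isIrreducible {k G V : Type} [Field k] [IsAlgClosed k] [CharZero k] [Group G]
    [Finite G] [AddCommGroup V] [Module k V] [FiniteDimensional k V] (ρ : Representation k G V)
    (h : ρ.IsIrreducible) : Simple (FDRep.of ρ) := by
  have := Fintype.ofFinite G
  have := invertibleOfNonzero (show (Nat.card G : k) ≠ 0 by simp)
  have h1 := ρ.card_inv_mul_sum_char_mul_char_eq_finrank ρ
  rw [Representation.IsIrreducible.finrank_intertwiningMap_self, Nat.cast_one,
    inv_mul_eq_one₀ (by simp)] at h1
  exact (simple_iff_char_is_norm_one _).2 h1.symm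

end FDRep

/-- The embedding of `S_m` into `S_{m+1}` as the stabilizer of the last point. -/
noncomputable def permLastHom (m : ℕ) : Equiv.Perm (Fin m) →* Equiv.Perm (Fin (m + 1)) :=
  Equiv.Perm.extendDomainHom (finSuccAboveEquiv (Fin.last m))

theorem permLastHom_castSucc {m : ℕ} (h : Equiv.Perm (Fin m)) (i : Fin m) :
    permLastHom m h i.castSucc = (h i).castSucc := by
  have := Equiv.Perm.extendDomain_apply_image h (finSuccAboveEquiv (Fin.last m)) i
  simpa [finSuccAboveEquiv_apply] using! this

theorem permLastHom_last {m : ℕ} (h : Equiv.Perm (Fin m)) :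
    permLastHom m h (Fin.last m) = Fin.last m :=
  Equiv.Perm.extendDomain_apply_not_subtype h _ (by simp)

theorem sign_permLastHom {m : ℕ} (h : Equiv.Perm (Fin m)) :
    Equiv.Perm.sign (permLastHom m h) = Equiv.Perm.sign h :=
  Equiv.Perm.sign_extendDomain h _

theorem eq_permLastHom {m : ℕ} {g : Equiv.Perm (Fin (m + 1))} {h : Equiv.Perm (Fin m)}
    (hg : g (Fin.last m) = Fin.last m) (hgh : ∀ i : Fin m, g i.castSucc = (h i).castSucc) :
    g = permLastHom m h := by
  ext1 i
  induction i using Fin.lastCases with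
  | last => rw [hg, permLastHom_last]
  | cast i => rw [hgh, permLastHom_castSucc]

theorem exists_eq_permLastHom {m : ℕ} {g : Equiv.Perm (Fin (m + 1))}
    (hg : g (Fin.last m) = Fin.last m) : ∃ h, g = permLastHom m h := by
  have hp : ∀ x, g x ≠ Fin.last m ↔ x ≠ Fin.last m := fun x => by
    rw [← hg, g.injective.ne_iff, hg]
  refine ⟨(finSuccAboveEquiv (Fin.last m)).permCongr.symm (g.subtypePerm hp),
    eq_permLastHom hg fun i => ?_⟩
  have := congrArg Subtype.val ((finSuccAboveEquiv (Fin.last m)).apply_symm_apply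
    (g.subtypePerm hp (finSuccAboveEquiv (Fin.last m) i)))
  rw [← Fin.succAbove_last_apply, ← Fin.succAbove_last_apply]
  exact this.symm

theorem re_character_le_of_normChar_le {m : ℕ} {W : Type} [AddCommGroup W] [Module ℂ W]
    [FiniteDimensional ℂ W] {τ : Representation ℂ (Equiv.Perm (Fin m)) W} {c : ℝ}
    {g : Equiv.Perm (Fin m)} [Nontrivial W] (h : normChar (FDRep.of τ) g ≤ c) :
    (τ.character g).re ≤ c * Module.finrank ℂ W := by
  have h' : (τ.character g / τ.character 1).re ≤ c := h
  have hpos : (0 : ℝ) < Module.finrank ℂ W := by exact_mod_cast Module.finrank_pos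
  rw [Representation.char_one, ← Complex.ofReal_natCast, Complex.div_ofReal_re,
    div_le_iff₀ hpos] at h'
  exact h'

theorem sign_smul_sign_smul {α W : Type*} [Fintype α] [DecidableEq α] [AddCommGroup W]
    [Module ℂ W] (g : Equiv.Perm α) (w : W) :
    ((Equiv.Perm.sign g : ℤ) : ℂ) • ((Equiv.Perm.sign g : ℤ) : ℂ) • w = w := by
  rcases Int.units_eq_one_or (Equiv.Perm.sign g) with h | h <;> simp [h]

/-- The tensor product of a representation of a symmetric group with the sign character. -/
def signTwist {α W : Type*} [Fintype α] [DecidableEq α] [AddCommGroup W] [Module ℂ W]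
    (ρ : Representation ℂ (Equiv.Perm α) W) : Representation ℂ (Equiv.Perm α) W where
  toFun g := ((Equiv.Perm.sign g : ℤ) : ℂ) • ρ g
  map_one' := by simp
  map_mul' g h := by
    ext w
    simp [smul_smul, mul_comm]

theorem signTwist_apply {α W : Type*} [Fintype α] [DecidableEq α] [AddCommGroup W] [Module ℂ W]
    (ρ : Representation ℂ (Equiv.Perm α) W) (g : Equiv.Perm α) (w : W) :
    signTwist ρ g w = ((Equiv.Perm.sign g : ℤ) : ℂ) • ρ g w := rfl

theorem character_signTwist {α W : Type*} [Fintype α] [DecidableEq α] [AddCommGroup W]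
    [Module ℂ W] (ρ : Representation ℂ (Equiv.Perm α) W) (g : Equiv.Perm α) :
    (signTwist ρ).character g = ((Equiv.Perm.sign g : ℤ) : ℂ) * ρ.character g :=
  map_smul (LinearMap.trace ℂ W) _ _

/-- **Corollary (std rules in `S_{n-1}` ⟹ std rules in `S_n`).** Let `n = m+1 ≥ 3`, let
`σ ∈ S_n` fix the last point, let `σ' ∈ S_{n-1}` be its restriction, and let
`f = c₁(σ) ≥ 1`. If every irreducible character `χ' ∉ {triv, sgn}` of `S_{n-1}` satisfies
`χ̃'(σ') ≤ (f-2)/(n-2)`, then every irreducible character `χ ∉ {triv, sgn}` of `S_n`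
satisfies `χ̃(σ) ≤ (f-1)/(n-1)`. -/
theorem std_rules_step (m : ℕ) (hm : 2 ≤ m)
    (σ : Equiv.Perm (Fin (m + 1))) (hσ : σ (Fin.last m) = Fin.last m)
    (σ' : Equiv.Perm (Fin m))
    (hσ' : ∀ i : Fin m, σ (Fin.castSucc i) = Fin.castSucc (σ' i))
    (hf : 1 ≤ fixCount σ)
    (hstd' : ∀ W : FDRep ℂ (Equiv.Perm (Fin m)), IsNontrivIrr W →
      normChar W σ' ≤ ((fixCount σ : ℝ) - 2) / (((m : ℝ) + 1) - 2)) :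
    ∀ V : FDRep ℂ (Equiv.Perm (Fin (m + 1))), IsNontrivIrr V →
      normChar V σ ≤ ((fixCount σ : ℝ) - 1) / (((m : ℝ) + 1) - 1) := by
  intro V hV
  obtain ⟨hsimple, hne1, hnes⟩ := hV
  have hirr := FDRep.isIrreducible_of_simple V
  have hsub := hirr.eq_bot_or_eq_top
  have hfixle : (fixCount σ : ℝ) ≤ m + 1 := by
    exact_mod_cast (Finset.card_filter_le _ _).trans_eq (by simp)
  have hfix1 : (1 : ℝ) ≤ fixCount σ := by exact_mod_cast hf
  have hm2 : (2 : ℝ) ≤ m := by exact_mod_cast hm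
  have hfix_one : fixCount (1 : Equiv.Perm (Fin (m + 1))) = m + 1 := by simp [fixCount]
  have hchar : V.character = Representation.character V.ρ := rfl
  have htriv : ∀ w, (∀ g, V.ρ g w = w) → w = 0 := by
    intro w hw
    by_contra hw0
    exact hne1 (Representation.character_eq_of_eigenvector hsub hw0
      (ε := fun _ => 1) fun g => by simp [hw])
  have hsgn : ∀ w, (∀ g, V.ρ g w = ((Equiv.Perm.sign g : ℤ) : ℂ) • w) → w = 0 := by
    intro w hw
    by_contra hw0
    exact hnes (Representation.character_eq_of_eigenvector hsub hw0
      (ε := fun g => ((Equiv.Perm.sign g : ℤ) : ℂ)) hw)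
  have hσι : σ = permLastHom m σ' := eq_permLastHom hσ hσ'
  by_cases hA : ∃ v, v ≠ 0 ∧ ∀ h, V.ρ (permLastHom m h) v = v
  · obtain ⟨v, hv0, hv⟩ := hA
    have key : ∀ g, Representation.character V.ρ g = (fixCount g : ℂ) - 1 :=
      Representation.character_eq_of_stabilizer_fixed V.ρ hsub htriv (Fin.last m) hv0
        fun g hg => by
          obtain ⟨h, rfl⟩ := exists_eq_permLastHom hg
          exact hv h
    have : V.character σ / V.character 1 =
        ((((fixCount σ : ℝ) - 1) / ((m : ℝ) + 1 - 1) : ℝ) : ℂ) := by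
      rw [hchar, key, key, hfix_one]
      push_cast
      rfl
    rw [normChar, this, Complex.ofReal_re]
  by_cases hB : ∃ v, v ≠ 0 ∧ ∀ h, V.ρ (permLastHom m h) v = ((Equiv.Perm.sign h : ℤ) : ℂ) • v
  · obtain ⟨v, hv0, hv⟩ := hB
    have key := fun g => Representation.character_eq_of_stabilizer_fixed (signTwist V.ρ)
      (fun U hU => hsub U fun g u hu => by
        have := U.smul_mem ((Equiv.Perm.sign g : ℤ) : ℂ) (hU g u hu)
        rwa [signTwist_apply, sign_smul_sign_smul] at this)
      (fun w hw => hsgn w fun g => by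
        conv_rhs => rw [← hw g]
        rw [signTwist_apply, sign_smul_sign_smul]) (Fin.last m) hv0
      (fun g hg => by
          obtain ⟨h, rfl⟩ := exists_eq_permLastHom hg
          rw [signTwist_apply, hv h, sign_permLastHom, sign_smul_sign_smul]) g
    have key' : ∀ g, Representation.character V.ρ g =
        ((Equiv.Perm.sign g : ℤ) : ℂ) * ((fixCount g : ℂ) - 1) := by
      intro g
      have h1 := key g
      rw [character_signTwist] at h1
      have h2 := congrArg (fun z => ((Equiv.Perm.sign g : ℤ) : ℂ) • z) h1
      rwa [← smul_eq_mul, sign_smul_sign_smul] at h2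
    have : V.character σ / V.character 1 =
        ((((Equiv.Perm.sign σ : ℤ) * ((fixCount σ : ℝ) - 1)) / ((m : ℝ) + 1 - 1) : ℝ) : ℂ) := by
      rw [hchar, key', key', hfix_one]
      simp
    rw [normChar, this, Complex.ofReal_re]
    refine div_le_div_of_nonneg_right ?_ (by linarith)
    rcases Int.units_eq_one_or (Equiv.Perm.sign σ) with h | h <;> rw [h] <;> push_cast <;> linarith
  push Not at hA hB
  have hbound := Representation.re_character_le_of_irreducible
    {(fun _ => 1 : Equiv.Perm (Fin m) → ℂ), fun g => ((Equiv.Perm.sign g : ℤ) : ℂ)}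
    (((fixCount σ : ℝ) - 2) / (((m : ℝ) + 1) - 2)) σ' (fun W _ _ _ τ hτ hS => by
      have hnt : Nontrivial W := by
        by_contra hcon
        rw [not_nontrivial_iff_subsingleton] at hcon
        exact bot_ne_top (α := Subrepresentation τ)
          (Subrepresentation.toSubmodule_injective (Subsingleton.elim _ _))
      have hne : ∀ ε ∈ ({(fun _ => 1 : Equiv.Perm (Fin m) → ℂ),
          fun g => ((Equiv.Perm.sign g : ℤ) : ℂ)} : Set (Equiv.Perm (Fin m) → ℂ)),
          ε 1 = 1 → τ.character ≠ ε := by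
        intro ε hε hε1 hτε
        have hrank : Module.finrank ℂ W = 1 := by
          rw [← hτε, Representation.char_one] at hε1
          exact_mod_cast hε1
        obtain ⟨w, hw⟩ := exists_ne (0 : W)
        exact hw (hS ε hε w fun g => by
          rw [τ.apply_eq_smul_of_finrank_eq_one hrank, hτε])
      refine re_character_le_of_normChar_le (hstd' (FDRep.of τ)
        ⟨FDRep.simple_of_isIrreducible τ hτ, hne _ (by simp) rfl, hne _ (by simp) (by simp)⟩))
    V (MonoidHom.comp V.ρ (permLastHom m)) (by
      rintro ε (rfl | rfl) w hw
      · by_contra hw0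
        obtain ⟨h, hh⟩ := hA w hw0
        exact hh (by simpa using hw h)
      · by_contra hw0
        obtain ⟨h, hh⟩ := hB w hw0
        exact hh (hw h))
  have hnt : Nontrivial V := by
    by_contra hcon
    rw [not_nontrivial_iff_subsingleton] at hcon
    exact bot_ne_top (α := Subrepresentation V.ρ)
      (Subrepresentation.toSubmodule_injective (Subsingleton.elim _ _))
  have hpos : (0 : ℝ) < Module.finrank ℂ V := by exact_mod_cast Module.finrank_pos
  have h1 : normChar V σ ≤ ((fixCount σ : ℝ) - 2) / (((m : ℝ) + 1) - 2) := by
    rw [normChar, hchar, Representation.char_one, ← Complex.ofReal_natCast,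
      Complex.div_ofReal_re, div_le_iff₀ hpos, hσι]
    rw [hσι] at hbound
    exact hbound
  refine h1.trans ?_
  rw [div_le_div_iff₀ (by linarith) (by linarith)]
  nlinarith
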